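/- Let (P, 𝒪) be a semitopology. Then the following are equivalent: (1) every point of P is regular; (2) P partitions into topen sets, i.e. there exists a family 𝒯 of topens with T ∩ T' = ∅ for all distinct T, T' ∈ 𝒯 and ⋃𝒯 = P; (3) every subset X ⊆ P is covered by topen sets, i.e. there exists a family 𝒯 of topens with X ⊆ ⋃𝒯. -/

import Mathlib

namespace Semitop

variable {P : Type*}

/-- A semitopology: a collection of open sets containing `∅` and `univ`,
closed under arbitrary unions. -/
def IsSemitop (𝒪 : Set (Set P)) : Prop :=
  ∅ ∈ 𝒪 ∧ Set.univ ∈ 𝒪 ∧ ∀ S ⊆ 𝒪, ⋃₀ S ∈ 𝒪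

/-- `T` is transitive: any two opens that intersect `T` intersect each other. -/
def IsTrans (𝒪 : Set (Set P)) (T : Set P) : Prop :=
  ∀ O ∈ 𝒪, ∀ O' ∈ 𝒪, (O ∩ T).Nonempty → (T ∩ O').Nonempty → (O ∩ O').Nonempty

/-- A topen is a nonempty transitive open set. -/
def IsTopen (𝒪 : Set (Set P)) (T : Set P) : Prop :=
  T.Nonempty ∧ IsTrans 𝒪 T ∧ T ∈ 𝒪

/-- A maximal topen: a topen contained in no strictly larger topen. -/
def MaxTopen (𝒪 : Set (Set P)) (S : Set P) : Prop :=
  IsTopen 𝒪 S ∧ ∀ S', IsTopen 𝒪 S' → S ⊆ S' → S' = S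

/-- `f` (into a discrete space of values) is continuous at `p`:
`f` is constant on some open neighbourhood of `p`. -/
def ContAt (𝒪 : Set (Set P)) {Val : Type*} (f : P → Val) (p : P) : Prop :=
  ∃ O ∈ 𝒪, p ∈ O ∧ ∀ q ∈ O, f q = f p

/-- `p` and `p'` are intertwined: every open neighbourhood of `p`
intersects every open neighbourhood of `p'`. -/
def Intw (𝒪 : Set (Set P)) (p p' : P) : Prop :=
  ∀ O ∈ 𝒪, ∀ O' ∈ 𝒪, p ∈ O → p' ∈ O' → (O ∩ O').Nonempty

/-- The set of points intertwined with `p`. -/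
def intwSet (𝒪 : Set (Set P)) (p : P) : Set P := {p' | Intw 𝒪 p p'}

/-- The interior of `R`: the union of all open subsets of `R`. -/
def sInterior (𝒪 : Set (Set P)) (R : Set P) : Set P := ⋃₀ {O | O ∈ 𝒪 ∧ O ⊆ R}

/-- The community of `p`: the interior of the set of points intertwined with `p`. -/
def community (𝒪 : Set (Set P)) (p : P) : Set P := sInterior 𝒪 (intwSet 𝒪 p)

/-- `p` is regular: `p ∈ community p` and `community p` is topen. -/
def Regular (𝒪 : Set (Set P)) (p : P) : Prop :=
  p ∈ community 𝒪 p ∧ IsTopen 𝒪 (community 𝒪 p)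

/-- `p` is weakly regular: `p ∈ community p`. -/
def WeaklyRegular (𝒪 : Set (Set P)) (p : P) : Prop := p ∈ community 𝒪 p

/-- Closure of a set: points all of whose open neighbourhoods intersect the set. -/
def sClosure (𝒪 : Set (Set P)) (S : Set P) : Set P :=
  {q | ∀ O ∈ 𝒪, q ∈ O → (O ∩ S).Nonempty}

/-- A set is closed when it equals its closure. -/
def IsClosedS (𝒪 : Set (Set P)) (C : Set P) : Prop := C = sClosure 𝒪 C

/-- `C` is a closed neighbourhood of `p`: closed with `p` in its interior. -/
def ClosedNbhdOf (𝒪 : Set (Set P)) (C : Set P) (p : P) : Prop :=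
  IsClosedS 𝒪 C ∧ p ∈ sInterior 𝒪 C

/-- `C` is a closed neighbourhood: closed with nonempty interior. -/
def ClosedNbhd (𝒪 : Set (Set P)) (C : Set P) : Prop :=
  IsClosedS 𝒪 C ∧ (sInterior 𝒪 C).Nonempty

/-- `p` is unconflicted: being intertwined is transitive through `p`. -/
def Unconflicted (𝒪 : Set (Set P)) (p : P) : Prop :=
  ∀ p' p'', Intw 𝒪 p' p → Intw 𝒪 p p'' → Intw 𝒪 p' p''

/-- `p` is strongly compatible: if `O'` and `O''` each intersect every
open neighbourhood of `p`, then `O'` intersects `O''`. -/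
def StrongCompat (𝒪 : Set (Set P)) (p : P) : Prop :=
  ∀ O' ∈ 𝒪, ∀ O'' ∈ 𝒪,
    (∀ O ∈ 𝒪, p ∈ O → (O' ∩ O).Nonempty ∧ (O ∩ O'').Nonempty) →
      (O' ∩ O'').Nonempty

theorem Intw.symm {𝒪 : Set (Set P)} {p q : P} (h : Intw 𝒪 p q) : Intw 𝒪 q p := by
  intro O hO O' hO' hq hp
  rw [Set.inter_comm]
  exact h O' hO' O hO hp hq

/-- Points of a common topen are intertwined with the same points. -/
theorem IsTopen.intw_of_intw {𝒪 : Set (Set P)} {T : Set P} (hT : IsTopen 𝒪 T) {p q x : P}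
    (hp : p ∈ T) (hq : q ∈ T) (h : Intw 𝒪 p x) : Intw 𝒪 q x :=
  fun O hO O' hO' hqO hxO' => hT.2.1 O hO O' hO' ⟨q, hqO, hq⟩ (h T hT.2.2 O' hO' hp hxO')

theorem IsTopen.community_eq {𝒪 : Set (Set P)} {T : Set P} (hT : IsTopen 𝒪 T) {p q : P}
    (hp : p ∈ T) (hq : q ∈ T) : community 𝒪 p = community 𝒪 q := by
  have h : intwSet 𝒪 p = intwSet 𝒪 q :=
    Set.ext fun _ => ⟨hT.intw_of_intw hp hq, hT.intw_of_intw hq hp⟩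
  rw [community, community, h]

theorem IsTopen.subset_community {𝒪 : Set (Set P)} {T : Set P} (hT : IsTopen 𝒪 T) {p : P}
    (hp : p ∈ T) : T ⊆ community 𝒪 p :=
  Set.subset_sUnion_of_mem ⟨hT.2.2, fun q hq O hO O' hO' hpO hqO' =>
    hT.2.1 O hO O' hO' ⟨p, hpO, hp⟩ ⟨q, hq, hqO'⟩⟩

theorem sInterior_subset (𝒪 : Set (Set P)) (R : Set P) : sInterior 𝒪 R ⊆ R :=
  Set.sUnion_subset fun _ h => h.2

theorem IsSemitop.sInterior_mem {𝒪 : Set (Set P)} (hST : IsSemitop 𝒪) (R : Set P) :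
    sInterior 𝒪 R ∈ 𝒪 :=
  hST.2.2 _ fun _ h => h.1

/-- Every point of a topen is regular. -/
theorem IsTopen.regular {𝒪 : Set (Set P)} (hST : IsSemitop 𝒪) {T : Set P} (hT : IsTopen 𝒪 T)
    {p : P} (hp : p ∈ T) : Regular 𝒪 p := by
  have hmem : p ∈ community 𝒪 p := hT.subset_community hp hp
  refine ⟨hmem, ⟨p, hmem⟩, ?_, hST.sInterior_mem _⟩
  rintro O hO O' hO' ⟨q, hqO, hq⟩ ⟨r, hr, hrO'⟩
  have hpq : Intw 𝒪 p q := sInterior_subset 𝒪 _ hq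
  have hpr : Intw 𝒪 p r := sInterior_subset 𝒪 _ hr
  exact hT.2.1 O hO O' hO' (hpq.symm O hO T hT.2.2 hqO hp) (hpr T hT.2.2 O' hO' hp hrO')

theorem regular_space_tfae {P : Type*}
    (𝒪 : Set (Set P)) (hST : IsSemitop 𝒪) :
    List.TFAE [
      ∀ p : P, Regular 𝒪 p,
      ∃ 𝒯 : Set (Set P), (∀ T ∈ 𝒯, IsTopen 𝒪 T) ∧
        (∀ T ∈ 𝒯, ∀ T' ∈ 𝒯, T ≠ T' → T ∩ T' = ∅) ∧ ⋃₀ 𝒯 = Set.univ,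
      ∀ X : Set P, ∃ 𝒯 : Set (Set P), (∀ T ∈ 𝒯, IsTopen 𝒪 T) ∧ X ⊆ ⋃₀ 𝒯 ] := by
  tfae_have 1 → 2 := by
    intro h
    refine ⟨Set.range (community 𝒪), ?_, ?_, ?_⟩
    · rintro _ ⟨p, rfl⟩
      exact (h p).2
    · rintro _ ⟨p, rfl⟩ _ ⟨p', rfl⟩ hne
      by_contra hinter
      obtain ⟨q, hq, hq'⟩ := Set.nonempty_iff_ne_empty.mpr hinter
      exact hne (((h p).2.community_eq (h p).1 hq).trans
        ((h p').2.community_eq hq' (h p').1))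
    · exact Set.eq_univ_of_forall fun p => ⟨_, ⟨p, rfl⟩, (h p).1⟩
  tfae_have 2 → 3 := by
    rintro ⟨𝒯, hT, -, hU⟩ X
    exact ⟨𝒯, hT, hU ▸ Set.subset_univ X⟩
  tfae_have 3 → 1 := by
    intro h p
    obtain ⟨𝒯, hT, hU⟩ := h Set.univ
    obtain ⟨T, hmem, hp⟩ := hU (Set.mem_univ p)
    exact (hT T hmem).regular hST hp
  tfae_finish

end Semitop
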